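/- (Fully adversarial side information.) Let X be a set and let φ : X^n × {−1,+1}^n → ℝ be stable in its second argument, i.e. |φ(x; y_{1:t−1},+1,y_{t+1:n}) − φ(x; y_{1:t−1},−1,y_{t+1:n})| ≤ 1/n for all x ∈ X^n, t, y. Suppose on each round t an adversary chooses x_t ∈ X as a function of the history (x_s, y_s, ŷ_s)_{s<t}, the forecaster draws ŷ_t ∈ {−1,+1} with mean q_t(x_{1:t}, y_{1:t−1}) ∈ [−1,1] using fresh independent randomness, and the adversary then chooses y_t ∈ {−1,+1} as a function of the history and x_t and ŷ_t's distribution. Then there exists a strategy (q_t)_{t=1}^n such that for every such adaptive adversary, E[ (1/n) Σ_{t=1}^n 1{ŷ_t ≠ y_t} ] ≤ E[ φ(x_{1:n}; y_{1:n}) ], if and only if for every X-valued tree z = (z_1,…,z_n) — that is, every collection of functions z_t : {−1,+1}^{t−1} → X — one has E_ε φ( z_1, z_2(ε_1), …, z_n(ε_{1:n−1}); ε ) ≥ 1/2, where ε = (ε_1,…,ε_n) is uniform on {−1,+1}^n. -/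

import Mathlib

open Finset

noncomputable section

/-- The real ±1 value of a Boolean bit (`true ↦ +1`, `false ↦ -1`). -/
def sgn (b : Bool) : ℝ := if b then 1 else -1

/-- The history (prefix) of the sequence `y` strictly before time `t`. -/
def pref {n : ℕ} (y : Fin n → Bool) (t : Fin n) : Fin t.1 → Bool :=
  fun s => y ⟨s.1, s.2.trans t.2⟩

/-- The realized play `(x_t, y_t)` of the game between the forecaster's strategy `q` and the
adaptive adversary `(ax, ay)`, given the realization `yh` of the forecaster's predictions:
`x_t = ax t (x_{<t}) (y_{<t}) (ŷ_{<t})` and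
`y_t = ay t (x_{<t}) (y_{<t}) (ŷ_{<t}) x_t (q_t(x_{1:t}, y_{<t}))`
(the adversary may use the distribution of `ŷ_t`, i.e. its mean `q_t`, but not `ŷ_t` itself). -/
def run {n : ℕ} {X : Type*}
    (q : (t : Fin n) → (Fin (t.1 + 1) → X) → (Fin t.1 → Bool) → ℝ)
    (ax : (t : Fin n) → (Fin t.1 → X) → (Fin t.1 → Bool) → (Fin t.1 → Bool) → X)
    (ay : (t : Fin n) → (Fin t.1 → X) → (Fin t.1 → Bool) → (Fin t.1 → Bool) → X → ℝ → Bool)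
    (yh : Fin n → Bool) : (t : Fin n) → X × Bool
  | t =>
    let xp : Fin t.1 → X := fun s => (run q ax ay yh ⟨s.1, s.2.trans t.2⟩).1
    let yp : Fin t.1 → Bool := fun s => (run q ax ay yh ⟨s.1, s.2.trans t.2⟩).2
    let yhp : Fin t.1 → Bool := fun s => yh ⟨s.1, s.2.trans t.2⟩
    let xt : X := ax t xp yp yhp
    (xt, ay t xp yp yhp xt
      (q t (fun s : Fin (t.1 + 1) => if h : s.1 < t.1 then xp ⟨s.1, h⟩ else xt) yp))
  termination_by t => t.1

/-- The probability that the forecaster's fresh coins come out as `yh` when playing strategy `q`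
against the adversary `(ax, ay)`. -/
def coinWeight {n : ℕ} {X : Type*}
    (q : (t : Fin n) → (Fin (t.1 + 1) → X) → (Fin t.1 → Bool) → ℝ)
    (ax : (t : Fin n) → (Fin t.1 → X) → (Fin t.1 → Bool) → (Fin t.1 → Bool) → X)
    (ay : (t : Fin n) → (Fin t.1 → X) → (Fin t.1 → Bool) → (Fin t.1 → Bool) → X → ℝ → Bool)
    (yh : Fin n → Bool) : ℝ :=
  ∏ t : Fin n,
    (1 + sgn (yh t) *
        q t (fun s => (run q ax ay yh ⟨s.1, s.2.trans_le t.isLt⟩).1)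
          (fun s => (run q ax ay yh ⟨s.1, s.2.trans t.2⟩).2)) / 2

open Function in
/-- Supermartingale-type telescoping lemma for a process driven by sequentially drawn bits. -/
theorem aux_super {n : ℕ} (w : Fin n → (Fin n → Bool) → ℝ) (hw : ∀ t y, 0 ≤ w t y)
    (hloc : ∀ t y y', (∀ s, s ≤ t → y s = y' s) → w t y = w t y')
    (hsum : ∀ t y, w t (update y t true) + w t (update y t false) = 1)
    (G : ℕ → (Fin n → Bool) → ℝ) (c : ℝ)
    (hG : ∀ (k : Fin n) y, w k (update y k true) * G (k.1 + 1) (update y k true)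
      + w k (update y k false) * G (k.1 + 1) (update y k false) ≤ G k.1 y + c)
    (y : Fin n → Bool) :
    ∑ ε : Fin n → Bool, (∏ t, w t ε) * G n ε ≤ G 0 y + n * c := by
  have key : ∀ j k : ℕ, k + j = n → ∀ y : Fin n → Bool,
      ∑ ε ∈ univ.filter (fun ε : Fin n → Bool => ∀ s : Fin n, s.1 < k → ε s = y s),
        (∏ t ∈ univ.filter (fun t : Fin n => k ≤ t.1), w t ε) * G n ε ≤ G k y + j * c := by
    intro j
    induction j with
    | zero =>
      intro k hk y
      have hk' : k = n := by omega
      subst hk'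
      have h1 : univ.filter (fun ε : Fin k → Bool => ∀ s : Fin k, s.1 < k → ε s = y s) = {y} := by
        ext ε
        simp only [mem_filter, mem_univ, true_and, mem_singleton]
        constructor
        · intro h; funext s; exact h s s.2
        · rintro rfl; simp
      have h2 : univ.filter (fun t : Fin k => k ≤ t.1) = ∅ := by
        ext t; simp
      rw [h1, h2]; simp
    | succ j ih =>
      intro k hk y
      have hkn : k < n := by omega
      set K : Fin n := ⟨k, hkn⟩ with hK
      have hb : ∀ b : Bool,
          ∑ ε ∈ univ.filter (fun ε : Fin n → Bool => ∀ s : Fin n, s.1 < k + 1 → ε s = (update y K b) s),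
            (∏ t ∈ univ.filter (fun t : Fin n => k ≤ t.1), w t ε) * G n ε
          ≤ w K (update y K b) * (G (k + 1) (update y K b) + j * c) := by
        intro b
        have := mul_le_mul_of_nonneg_left (ih (k + 1) (by omega) (update y K b)) (hw K (update y K b))
        refine le_trans (le_of_eq ?_) this
        rw [Finset.mul_sum]
        refine Finset.sum_congr rfl ?_
        intro ε hε
        simp only [mem_filter, mem_univ, true_and] at hε
        have h3 : univ.filter (fun t : Fin n => k ≤ t.1)
            = insert K (univ.filter (fun t : Fin n => k + 1 ≤ t.1)) := by
          ext t
          simp only [mem_filter, mem_univ, true_and, mem_insert, Fin.ext_iff, hK]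
          omega
        rw [h3, Finset.prod_insert (by simp [hK]),
          hloc K ε (update y K b) (fun s hs => hε s (by
            have : s.1 ≤ k := hs
            omega))]
        ring
      have hsplit : univ.filter (fun ε : Fin n → Bool => ∀ s : Fin n, s.1 < k → ε s = y s)
          = univ.filter (fun ε : Fin n → Bool => ∀ s : Fin n, s.1 < k + 1 → ε s = (update y K true) s)
          ∪ univ.filter (fun ε : Fin n → Bool => ∀ s : Fin n, s.1 < k + 1 → ε s = (update y K false) s) := by
        ext ε
        simp only [mem_filter, mem_univ, true_and, mem_union]
        constructor
        · intro h
          have : ∀ b, ε K = b → ∀ s : Fin n, s.1 < k + 1 → ε s = (update y K b) s := by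
            intro b hb s hs
            by_cases hsk : s = K
            · subst hsk; simp [hb]
            · rw [update_of_ne hsk]
              apply h
              have : s.1 ≠ k := fun h => hsk (Fin.ext h)
              omega
          cases hb : ε K with
          | true => exact Or.inl (this _ hb)
          | false => exact Or.inr (this _ hb)
        · rintro (h | h) s hs
          all_goals
            have hsk : s ≠ K := by
              intro h; rw [h] at hs; simp [hK] at hs
            have := h s (by omega)
            rwa [update_of_ne hsk] at this
      have hdisj : Disjoint
          (univ.filter (fun ε : Fin n → Bool => ∀ s : Fin n, s.1 < k + 1 → ε s = (update y K true) s))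
          (univ.filter (fun ε : Fin n → Bool => ∀ s : Fin n, s.1 < k + 1 → ε s = (update y K false) s)) := by
        rw [Finset.disjoint_left]
        intro ε h1 h2
        simp only [mem_filter, mem_univ, true_and] at h1 h2
        have a1 := h1 K (by simp [hK])
        have a2 := h2 K (by simp [hK])
        simp at a1 a2
        rw [a1] at a2; simp at a2
      rw [hsplit, Finset.sum_union hdisj]
      have e1 := hb true
      have e2 := hb false
      have e3 := hG K y
      have e4 := hsum K y
      have e5 : w K (update y K true) * (j * c) + w K (update y K false) * (j * c) = j * c := by
        rw [← add_mul, e4, one_mul]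
      push_cast
      simp only [hK] at *
      linarith
  have := key n 0 (by omega) y
  simpa using this

/-- Backward-induction value of the game. -/
def aux_V {n : ℕ} {X : Type*} (φ : (Fin n → X) → (Fin n → Bool) → ℝ) (k : ℕ)
    (x : Fin n → X) (y : Fin n → Bool) : ℝ :=
  if h : k < n then
    ⨅ a : X, (aux_V φ (k + 1) (Function.update x ⟨k, h⟩ a) (Function.update y ⟨k, h⟩ true)
      + aux_V φ (k + 1) (Function.update x ⟨k, h⟩ a) (Function.update y ⟨k, h⟩ false)) / 2
  else φ x y
  termination_by n - k

theorem aux_V_n {n : ℕ} {X : Type*} (φ : (Fin n → X) → (Fin n → Bool) → ℝ)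
    (x : Fin n → X) (y : Fin n → Bool) : aux_V φ n x y = φ x y := by
  rw [aux_V]; simp

theorem aux_V_lt {n : ℕ} {X : Type*} (φ : (Fin n → X) → (Fin n → Bool) → ℝ) (k : Fin n)
    (x : Fin n → X) (y : Fin n → Bool) : aux_V φ k.1 x y =
    ⨅ a : X, (aux_V φ (k.1 + 1) (Function.update x k a) (Function.update y k true)
      + aux_V φ (k.1 + 1) (Function.update x k a) (Function.update y k false)) / 2 := by
  rw [aux_V]; simp

/-- Downward induction principle. -/
theorem aux_down {n : ℕ} (P : ℕ → Prop) (h0 : P n) (h1 : ∀ k : Fin n, P (k.1 + 1) → P k.1) :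
    ∀ k, k ≤ n → P k := by
  have key : ∀ j k : ℕ, k + j = n → P k := by
    intro j
    induction j with
    | zero =>
      intro k hk
      have : k = n := by omega
      rwa [this]
    | succ j ih =>
      intro k hk
      exact h1 ⟨k, by omega⟩ (ih (k + 1) (by omega))
  intro k hk
  exact key (n - k) k (by omega)

theorem aux_V_loc {n : ℕ} {X : Type*} (φ : (Fin n → X) → (Fin n → Bool) → ℝ) :
    ∀ k, k ≤ n → ∀ (x x' : Fin n → X) (y y' : Fin n → Bool),
      (∀ s : Fin n, s.1 < k → x s = x' s) → (∀ s : Fin n, s.1 < k → y s = y' s) →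
      aux_V φ k x y = aux_V φ k x' y' := by
  apply aux_down
  · intro x x' y y' hx hy
    have : x = x' := funext fun s => hx s s.2
    have : y = y' := funext fun s => hy s s.2
    subst_vars; rfl
  · intro k ih x x' y y' hx hy
    have hu : ∀ {α : Type _} (x x' : Fin n → α) (a : α), (∀ s : Fin n, s.1 < k.1 → x s = x' s) →
        ∀ s : Fin n, s.1 < k.1 + 1 → Function.update x k a s = Function.update x' k a s := by
      intro α x x' a h s hs
      by_cases hsk : s = k
      · subst hsk; simp
      · rw [Function.update_of_ne hsk, Function.update_of_ne hsk]
        apply h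
        have : s.1 ≠ k.1 := fun h => hsk (Fin.ext h)
        omega
    have hu' : ∀ (x x' : Fin n → Bool) (a : Bool), (∀ s : Fin n, s.1 < k.1 → x s = x' s) →
        ∀ s : Fin n, s.1 < k.1 + 1 → Function.update x k a s = Function.update x' k a s := by
      intro x x' a h s hs
      by_cases hsk : s = k
      · subst hsk; simp
      · rw [Function.update_of_ne hsk, Function.update_of_ne hsk]
        apply h
        have : s.1 ≠ k.1 := fun h => hsk (Fin.ext h)
        omega
    rw [aux_V_lt, aux_V_lt]
    refine iInf_congr fun a => ?_
    rw [ih _ _ _ _ (hu x x' a hx) (hu' y y' true hy), ih _ _ _ _ (hu x x' a hx) (hu' y y' false hy)]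

theorem aux_V_lb {n : ℕ} {X : Type*} [Nonempty X] (φ : (Fin n → X) → (Fin n → Bool) → ℝ) (m : ℝ)
    (hm : ∀ x y, m ≤ φ x y) :
    ∀ k, k ≤ n → ∀ (x : Fin n → X) (y : Fin n → Bool), m ≤ aux_V φ k x y := by
  apply aux_down
  · intro x y; rw [aux_V_n]; exact hm x y
  · intro k ih x y
    rw [aux_V_lt]
    refine le_ciInf fun a => ?_
    linarith [ih (Function.update x k a) (Function.update y k true),
      ih (Function.update x k a) (Function.update y k false)]

theorem aux_V_bdd {n : ℕ} {X : Type*} [Nonempty X] (φ : (Fin n → X) → (Fin n → Bool) → ℝ) (m : ℝ)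
    (hm : ∀ x y, m ≤ φ x y) (k : Fin n) (x : Fin n → X) (y : Fin n → Bool) :
    BddBelow (Set.range fun a : X =>
      (aux_V φ (k.1 + 1) (Function.update x k a) (Function.update y k true)
      + aux_V φ (k.1 + 1) (Function.update x k a) (Function.update y k false)) / 2) := by
  refine ⟨m, ?_⟩
  rintro _ ⟨a, rfl⟩
  have := aux_V_lb φ m hm (k.1 + 1) k.2
  dsimp only
  linarith [this (Function.update x k a) (Function.update y k true),
      this (Function.update x k a) (Function.update y k false)]

theorem aux_V_stable {n : ℕ} {X : Type*} [Nonempty X] (φ : (Fin n → X) → (Fin n → Bool) → ℝ)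
    (m : ℝ) (hm : ∀ x y, m ≤ φ x y) (d : ℝ) (hd : 0 ≤ d)
    (hs : ∀ x y t b, φ x y ≤ φ x (Function.update y t b) + d) :
    ∀ k, k ≤ n → ∀ (x : Fin n → X) (y : Fin n → Bool) (t : Fin n) (b : Bool),
      aux_V φ k x y ≤ aux_V φ k x (Function.update y t b) + d := by
  apply aux_down
  · intro x y t b; rw [aux_V_n, aux_V_n]; exact hs x y t b
  · intro k ih x y t b
    rw [aux_V_lt φ k x (Function.update y t b), ← sub_le_iff_le_add]
    refine le_ciInf fun a => ?_
    have h1 : aux_V φ k.1 x y ≤ _ := (aux_V_lt φ k x y).trans_le (ciInf_le (aux_V_bdd φ m hm k x y) a)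
    by_cases htk : t = k
    · subst htk
      rw [Function.update_idem, Function.update_idem]
      linarith
    · rw [Function.update_comm htk, Function.update_comm htk]
      linarith [ih (Function.update x k a) (Function.update y k true) t b,
        ih (Function.update x k a) (Function.update y k false) t b]

theorem aux_run_loc {n : ℕ} {X : Type*}
    (q : (t : Fin n) → (Fin (t.1 + 1) → X) → (Fin t.1 → Bool) → ℝ)
    (ax : (t : Fin n) → (Fin t.1 → X) → (Fin t.1 → Bool) → (Fin t.1 → Bool) → X)
    (ay : (t : Fin n) → (Fin t.1 → X) → (Fin t.1 → Bool) → (Fin t.1 → Bool) → X → ℝ → Bool)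
    (yh yh' : Fin n → Bool) : ∀ (j : ℕ) (t : Fin n), t.1 = j → (∀ s, s < t → yh s = yh' s) →
      run q ax ay yh t = run q ax ay yh' t := by
  intro j
  induction j using Nat.strong_induction_on with
  | _ j ih =>
    intro t ht h
    have e1 : ∀ s : Fin t.1, run q ax ay yh ⟨s.1, s.2.trans t.2⟩
        = run q ax ay yh' ⟨s.1, s.2.trans t.2⟩ := by
      intro s
      refine ih s.1 (by omega) _ rfl ?_
      intro u hu
      exact h u (lt_trans hu s.2)
    have e2 : ∀ s : Fin t.1, yh ⟨s.1, s.2.trans t.2⟩ = yh' ⟨s.1, s.2.trans t.2⟩ :=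
      fun s => h _ s.2
    rw [run, run]
    have e3 : (fun s : Fin t.1 => run q ax ay yh ⟨s.1, s.2.trans t.2⟩)
        = (fun s : Fin t.1 => run q ax ay yh' ⟨s.1, s.2.trans t.2⟩) := funext e1
    have e4 : (fun s : Fin t.1 => yh ⟨s.1, s.2.trans t.2⟩)
        = (fun s : Fin t.1 => yh' ⟨s.1, s.2.trans t.2⟩) := funext e2
    exact congrArg₂ (fun (r : Fin t.1 → X × Bool) (yhp : Fin t.1 → Bool) =>
      let xt : X := ax t (fun s => (r s).1) (fun s => (r s).2) yhp
      ((xt, ay t (fun s => (r s).1) (fun s => (r s).2) yhp xt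
        (q t (fun s : Fin (t.1 + 1) => if h : s.1 < t.1 then (r ⟨s.1, h⟩).1 else xt)
          (fun s => (r s).2))) : X × Bool)) e3 e4

/-- Lower bound on the value of the game from the tree condition. -/
theorem aux_V_zero {n : ℕ} {X : Type*} [Nonempty X] (φ : (Fin n → X) → (Fin n → Bool) → ℝ)
    (m : ℝ) (hm : ∀ x y, m ≤ φ x y)
    (hz : ∀ z : (t : Fin n) → (Fin t.1 → Bool) → X,
      1 / 2 ≤ (∑ ε : Fin n → Bool, φ (fun t => z t (pref ε t)) ε) / 2 ^ n)
    (x : Fin n → X) (y : Fin n → Bool) : 1 / 2 ≤ aux_V φ 0 x y := by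
  refine le_of_forall_pos_le_add fun δ' hδ' => ?_
  obtain ⟨δ, hδ, hnδ⟩ : ∃ δ : ℝ, 0 < δ ∧ n * δ ≤ δ' := by
    refine ⟨δ' / (n + 1), by positivity, ?_⟩
    rw [mul_div_assoc', div_le_iff₀ (by positivity)]
    nlinarith
  have hA : ∀ (k : Fin n) (x : Fin n → X) (y : Fin n → Bool), ∃ a : X,
      (aux_V φ (k.1 + 1) (Function.update x k a) (Function.update y k true)
      + aux_V φ (k.1 + 1) (Function.update x k a) (Function.update y k false)) / 2
      < aux_V φ k.1 x y + δ := by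
    intro k x y
    apply exists_lt_of_ciInf_lt
    rw [← aux_V_lt]
    linarith
  choose A hA using hA
  obtain ⟨x0⟩ := ‹Nonempty X›
  let ax : (t : Fin n) → (Fin t.1 → X) → (Fin t.1 → Bool) → (Fin t.1 → Bool) → X :=
    fun t xp _ yhp => A t (fun s => if h : s.1 < t.1 then xp ⟨s.1, h⟩ else x0)
      (fun s => if h : s.1 < t.1 then yhp ⟨s.1, h⟩ else true)
  let R : (Fin n → Bool) → Fin n → X := fun yh t =>
    (run (fun _ _ _ => 0) ax (fun _ _ _ _ _ _ => true) yh t).1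
  have hRloc : ∀ yh yh' t, (∀ s, s < t → yh s = yh' s) → R yh t = R yh' t := by
    intro yh yh' t h
    simp only [R]
    rw [aux_run_loc _ _ _ yh yh' t.1 t rfl h]
  have hR : ∀ yh t, R yh t = A t (fun s => if s.1 < t.1 then R yh s else x0)
      (fun s => if s.1 < t.1 then yh s else true) := by
    intro yh t
    simp only [R]
    rw [run]
    rfl
  have hz' := hz (fun t h => R (fun s => if hs : s.1 < t.1 then h ⟨s.1, hs⟩ else true) t)
  have hz2 : ∀ ε : Fin n → Bool, (fun t : Fin n =>
      R (fun s => if hs : s.1 < t.1 then pref ε t ⟨s.1, hs⟩ else true) t) = R ε := by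
    intro ε
    funext t
    apply hRloc
    intro s hs
    have : s.1 < t.1 := hs
    simp [this, pref]
  simp only [hz2] at hz'
  have hsup := aux_super (n := n) (fun _ _ => 1 / 2) (fun _ _ => by norm_num)
    (fun _ _ _ _ => rfl) (fun _ _ => by norm_num) (fun k ε => aux_V φ k (R ε) ε) δ ?_ y
  · simp only [aux_V_n, prod_const, card_univ, Fintype.card_fin, ← Finset.mul_sum] at hsup
    have e : aux_V φ 0 (R y) y = aux_V φ 0 x y :=
      aux_V_loc φ 0 (Nat.zero_le _) _ _ _ _ (by simp) (by simp)
    rw [e] at hsup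
    have : (∑ ε : Fin n → Bool, φ (R ε) ε) / 2 ^ n
        = (1 / 2) ^ n * ∑ ε : Fin n → Bool, φ (R ε) ε := by
      rw [one_div, inv_pow]; ring
    linarith
  · intro k y
    have h1 := hA k (fun s => if s.1 < k.1 then R y s else x0)
      (fun s => if s.1 < k.1 then y s else true)
    rw [← hR] at h1
    have e0 : aux_V φ k.1 (fun s => if s.1 < k.1 then R y s else x0)
      (fun s => if s.1 < k.1 then y s else true) = aux_V φ k.1 (R y) y :=
      aux_V_loc φ k.1 k.2.le _ _ _ _ (fun s hs => by simp [hs]) (fun s hs => by simp [hs])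
    have eb : ∀ b, aux_V φ (k.1 + 1)
        (Function.update (fun s => if s.1 < k.1 then R y s else x0) k (R y k))
        (Function.update (fun s => if s.1 < k.1 then y s else true) k b)
        = aux_V φ (k.1 + 1) (R (Function.update y k b)) (Function.update y k b) := by
      intro b
      apply aux_V_loc φ (k.1 + 1) k.2
      · intro s hs
        have e : R (Function.update y k b) s = R y s := by
          apply hRloc
          intro u hu
          rw [Function.update_of_ne]
          rintro rfl
          have : u.1 < s.1 := hu
          omega
        rw [e]
        by_cases hsk : s = k
        · subst hsk; simp
        · have h' : s.1 ≠ k.1 := fun h => hsk (Fin.ext h)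
          rw [Function.update_of_ne hsk, if_pos (by omega)]
      · intro s hs
        by_cases hsk : s = k
        · subst hsk; simp
        · have h' : s.1 ≠ k.1 := fun h => hsk (Fin.ext h)
          rw [Function.update_of_ne hsk, Function.update_of_ne hsk, if_pos (by omega)]
    rw [e0, eb, eb] at h1
    linarith

theorem aux_sgn_abs (b : Bool) (r : ℝ) (h : |r| ≤ 1) : 0 ≤ (1 + sgn b * r) / 2 := by
  have := abs_le.mp h
  cases b <;> simp [sgn] <;> linarith

theorem aux_sum_succ {n : ℕ} (f : Fin n → ℝ) (k : Fin n) :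
    ∑ t ∈ univ.filter (fun t : Fin n => t.1 < k.1 + 1), f t
      = ∑ t ∈ univ.filter (fun t : Fin n => t.1 < k.1), f t + f k := by
  have h3 : univ.filter (fun t : Fin n => t.1 < k.1 + 1)
      = insert k (univ.filter (fun t : Fin n => t.1 < k.1)) := by
    ext t
    simp only [mem_filter, mem_univ, true_and, mem_insert, Fin.ext_iff]
    omega
  rw [h3, Finset.sum_insert (by simp)]
  ring

theorem aux_sum_all {n : ℕ} (f : Fin n → ℝ) :
    ∑ t ∈ univ.filter (fun t : Fin n => t.1 < n), f t = ∑ t, f t := by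
  simp

/-- Sum over a strict prefix is unchanged when summands agree there. -/
theorem aux_sum_congr {n : ℕ} (f g : Fin n → ℝ) (k : Fin n) (h : ∀ t, t < k → f t = g t) :
    ∑ t ∈ univ.filter (fun t : Fin n => t.1 < k.1), f t
      = ∑ t ∈ univ.filter (fun t : Fin n => t.1 < k.1), g t := by
  refine Finset.sum_congr rfl fun t ht => h t ?_
  simpa using ht

theorem aux_upd {n : ℕ} (y : Fin n → Bool) (k : Fin n) (b : Bool) :
    ∀ s, s < k → Function.update y k b s = y s :=
  fun _ hs => Function.update_of_ne (ne_of_lt hs) _ _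

/-- Fully adversarial side information: for `φ` stable in its second argument,
there is a strategy `(q_t)` guaranteeing, against every adaptive adversary choosing `x_t` from
the history and `y_t` from the history, `x_t` and the distribution of `ŷ_t`, expected proportion
of mistakes at most `E[φ(x_{1:n}; y_{1:n})]`, iff for every `X`-valued tree `z`,
`E_ε φ(z_1, z_2(ε_1), …, z_n(ε_{1:n−1}); ε) ≥ 1/2`. -/
theorem prediction_adversarial_side_information (n : ℕ) (hn : 1 ≤ n) {X : Type*}
    (φ : (Fin n → X) → (Fin n → Bool) → ℝ)
    (hstable : ∀ (x : Fin n → X) (y : Fin n → Bool) (t : Fin n),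
      |φ x (Function.update y t true) - φ x (Function.update y t false)| ≤ 1 / n) :
    (∃ q : (t : Fin n) → (Fin (t.1 + 1) → X) → (Fin t.1 → Bool) → ℝ,
      (∀ (t : Fin n) (xs : Fin (t.1 + 1) → X) (h : Fin t.1 → Bool), |q t xs h| ≤ 1) ∧
      ∀ (ax : (t : Fin n) → (Fin t.1 → X) → (Fin t.1 → Bool) → (Fin t.1 → Bool) → X)
        (ay : (t : Fin n) → (Fin t.1 → X) → (Fin t.1 → Bool) → (Fin t.1 → Bool) → X → ℝ → Bool),
        (∑ yh : Fin n → Bool,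
            coinWeight q ax ay yh *
              ((1 / n) * ∑ t : Fin n,
                if yh t ≠ (run q ax ay yh t).2 then (1 : ℝ) else 0)) ≤
        ∑ yh : Fin n → Bool,
          coinWeight q ax ay yh *
            φ (fun t => (run q ax ay yh t).1) (fun t => (run q ax ay yh t).2)) ↔
    (∀ z : (t : Fin n) → (Fin t.1 → Bool) → X,
      1 / 2 ≤ (∑ ε : Fin n → Bool, φ (fun t => z t (pref ε t)) ε) / 2 ^ n) := by
  have hn0 : (0 : ℝ) < n := by exact_mod_cast hn
  constructor
  · rintro ⟨q, hq, hadv⟩ z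
    -- the mean played on round `t` against the oblivious path `ε`
    let Q : (Fin n → Bool) → Fin n → ℝ := fun ε t =>
      q t (fun s => z ⟨s.1, s.2.trans_le t.isLt⟩ (pref ε ⟨s.1, s.2.trans_le t.isLt⟩)) (pref ε t)
    have hQloc : ∀ ε ε' t, (∀ s, s < t → ε s = ε' s) → Q ε t = Q ε' t := by
      intro ε ε' t h
      have e1 : ∀ s : Fin n, s ≤ t → pref ε s = pref ε' s := by
        intro s hs
        funext u
        exact h _ (lt_of_lt_of_le (show (⟨u.1, u.2.trans s.2⟩ : Fin n) < s from u.2) hs)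
      simp only [Q]
      rw [e1 t le_rfl]
      congr 1
      funext s
      rw [e1 _ (Nat.lt_succ_iff.mp s.2)]
    have step : ∀ ε : Fin n → Bool,
        ∑ t, (1 - sgn (ε t) * Q ε t) / (2 * n) ≤ φ (fun t => z t (pref ε t)) ε := by
      intro ε
      let ax : (t : Fin n) → (Fin t.1 → X) → (Fin t.1 → Bool) → (Fin t.1 → Bool) → X :=
        fun t _ yp _ => z t yp
      let ay : (t : Fin n) → (Fin t.1 → X) → (Fin t.1 → Bool) → (Fin t.1 → Bool) → X → ℝ → Bool :=
        fun t _ _ _ _ _ => ε t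
      have hy : ∀ yh t, (run q ax ay yh t).2 = ε t := by
        intro yh t; rw [run]
      have hx : ∀ yh t, (run q ax ay yh t).1 = z t (pref ε t) := by
        intro yh t
        rw [run]
        simp only [ax, hy]
        rfl
      have h := hadv ax ay
      have hcw : ∀ yh, coinWeight q ax ay yh = ∏ t, (1 + sgn (yh t) * Q ε t) / 2 := by
        intro yh
        simp only [coinWeight, hx, hy]
        rfl
      simp only [hx, hy, hcw] at h
      set F := φ (fun t => z t (pref ε t)) ε with hF
      have hs := aux_super (n := n) (fun t yh => (1 + sgn (yh t) * Q ε t) / 2)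
        (fun t yh => aux_sgn_abs _ _ (hq _ _ _))
        (fun t y y' h => by simp only [h t le_rfl])
        (fun t y => by simp [sgn]; ring)
        (fun k yh => ∑ t ∈ univ.filter (fun t : Fin n => t.1 < k),
            ((1 - sgn (ε t) * Q ε t) / (2 * n) - (1 / n) * (if yh t ≠ ε t then (1 : ℝ) else 0))
          + (F - ∑ t, (1 - sgn (ε t) * Q ε t) / (2 * n))) 0 ?_ (fun _ => true)
      · simp only [aux_sum_all] at hs
        simp only [not_lt_zero, filter_false, sum_empty, mul_zero, add_zero, zero_add] at hs
        have e : ∀ yh : Fin n → Bool,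
            (∑ t, ((1 - sgn (ε t) * Q ε t) / (2 * n)
                - (1 / n) * (if yh t ≠ ε t then (1 : ℝ) else 0))
              + (F - ∑ t, (1 - sgn (ε t) * Q ε t) / (2 * n)))
            = F - (1 / n) * ∑ t, (if yh t ≠ ε t then (1 : ℝ) else 0) := by
          intro yh
          rw [sum_sub_distrib, ← Finset.mul_sum]; ring
        rw [Finset.sum_congr rfl fun yh _ => by rw [e yh]] at hs
        simp only [mul_sub, sum_sub_distrib] at hs
        linarith
      · intro k y
        simp only [aux_sum_succ]
        rw [aux_sum_congr _ (fun t => ((1 - sgn (ε t) * Q ε t) / (2 * n)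
            - (1 / n) * (if y t ≠ ε t then (1 : ℝ) else 0))) k
            (fun t ht => by simp only [aux_upd y k true t ht]),
          aux_sum_congr (fun t => ((1 - sgn (ε t) * Q ε t) / (2 * n)
            - (1 / n) * (if Function.update y k false t ≠ ε t then (1 : ℝ) else 0)))
            (fun t => ((1 - sgn (ε t) * Q ε t) / (2 * n)
            - (1 / n) * (if y t ≠ ε t then (1 : ℝ) else 0))) k
            (fun t ht => by simp only [aux_upd y k false t ht])]
        generalize (∑ t ∈ univ.filter (fun t : Fin n => t.1 < k.1), ((1 - sgn (ε t) * Q ε t) / (2 * n)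
            - (1 / n) * (if y t ≠ ε t then (1 : ℝ) else 0))) = S
        generalize (F - ∑ t, (1 - sgn (ε t) * Q ε t) / (2 * n)) = T
        apply le_of_eq
        cases hk : ε k <;> simp [sgn] <;> field_simp <;> ring
    have hs := aux_super (n := n) (fun _ _ => 1 / 2) (fun _ _ => by norm_num)
      (fun _ _ _ _ => rfl) (fun _ _ => by norm_num)
      (fun k ε => - ∑ t ∈ univ.filter (fun t : Fin n => t.1 < k), (1 - sgn (ε t) * Q ε t) / (2 * n))
      (-(1 / (2 * n))) ?_ (fun _ => true)
    · simp only [aux_sum_all, prod_const, card_univ, Fintype.card_fin, ← Finset.mul_sum,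
        not_lt_zero, filter_false, sum_empty, sum_neg_distrib] at hs
      have h1 : ∑ ε : Fin n → Bool, ∑ t, (1 - sgn (ε t) * Q ε t) / (2 * n)
          ≤ ∑ ε : Fin n → Bool, φ (fun t => z t (pref ε t)) ε := sum_le_sum fun ε _ => step ε
      have h2 := mul_le_mul_of_nonneg_left h1 (show (0 : ℝ) ≤ (1 / 2) ^ n by positivity)
      have h3 : (n : ℝ) * (-(1 / (2 * n))) = - (1 / 2) := by field_simp
      have h4 : (∑ ε : Fin n → Bool, φ (fun t => z t (pref ε t)) ε) / 2 ^ n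
        = (1 / 2) ^ n * ∑ ε : Fin n → Bool, φ (fun t => z t (pref ε t)) ε := by
        rw [one_div, inv_pow]; ring
      rw [h3] at hs
      rw [h4]
      linarith
    · intro k y
      simp only [aux_sum_succ]
      have eq : ∀ b t, t ≤ k → Q (Function.update y k b) t = Q y t := by
        intro b t ht
        exact hQloc _ _ _ fun s hs => aux_upd y k b s (lt_of_lt_of_le hs ht)
      have es : ∀ b, ∑ t ∈ univ.filter (fun t : Fin n => t.1 < k.1),
            (1 - sgn (Function.update y k b t) * Q (Function.update y k b) t) / (2 * n)
          = ∑ t ∈ univ.filter (fun t : Fin n => t.1 < k.1), (1 - sgn (y t) * Q y t) / (2 * n) := by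
        intro b
        apply aux_sum_congr
        intro t ht
        rw [eq b t ht.le, aux_upd y k b t ht]
      rw [es, es, eq _ k le_rfl, eq _ k le_rfl]
      apply le_of_eq
      simp [sgn]
      field_simp
      ring
  · intro hz
    by_cases hX : Nonempty X
    swap
    · refine ⟨fun _ _ _ => 0, by simp, ?_⟩
      intro ax
      exact absurd ⟨ax ⟨0, hn⟩ (fun s => s.elim0) (fun s => s.elim0) (fun s => s.elim0)⟩ hX
    have hs1 : ∀ x y t b, φ x y ≤ φ x (Function.update y t b) + 1 / n := by
      intro x y t b
      have h := abs_le.mp (hstable x y t)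
      have h0 : (0 : ℝ) ≤ 1 / n := by positivity
      have e : φ x y = φ x (Function.update y t (y t)) := by rw [Function.update_eq_self]
      rw [e]
      cases b <;> cases y t <;> linarith
    -- a uniform lower bound on `φ`
    have hm : ∀ x y, (-1 / 2 : ℝ) ≤ φ x y := by
      intro x y
      have h1 := hz (fun t _ => x t)
      have h2 := aux_super (n := n) (fun _ _ => 1 / 2) (fun _ _ => by norm_num)
        (fun _ _ _ _ => rfl) (fun _ _ => by norm_num)
        (fun k ε => φ x (fun s => if s.1 < k then ε s else y s)) (1 / n) ?_ y
      · simp only [prod_const, card_univ, Fintype.card_fin, ← Finset.mul_sum, Fin.is_lt, if_true,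
          not_lt_zero, if_false] at h2
        have h3 : (n : ℝ) * (1 / n) = 1 := by field_simp
        have h4 : (∑ ε : Fin n → Bool, φ x ε) / 2 ^ n
          = (1 / 2) ^ n * ∑ ε : Fin n → Bool, φ x ε := by
          rw [one_div, inv_pow]; ring
        rw [h3] at h2
        rw [h4] at h1
        linarith
      · intro k ε
        have e : ∀ b, φ x (fun s => if s.1 < k.1 + 1 then Function.update ε k b s else y s)
            ≤ φ x (fun s => if s.1 < k.1 then ε s else y s) + 1 / n := by
          intro b
          refine le_trans (hs1 _ _ k (y k)) (le_of_eq ?_)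
          congr 2
          funext s
          by_cases hsk : s = k
          · subst hsk; simp
          · have : s.1 ≠ k.1 := fun h => hsk (Fin.ext h)
            have h2 : s.1 < k.1 + 1 ↔ s.1 < k.1 := by omega
            simp only [Function.update_of_ne hsk, h2]
        linarith [e true, e false]
    have hst := aux_V_stable φ _ hm (1 / n) (by positivity) hs1
    have hV0 := aux_V_zero φ _ hm hz
    obtain ⟨x0⟩ := id hX
    let px : (t : Fin n) → (Fin (t.1 + 1) → X) → Fin n → X :=
      fun t xs s => if h : s.1 < t.1 + 1 then xs ⟨s.1, h⟩ else x0
    let py : (t : Fin n) → (Fin t.1 → Bool) → Fin n → Bool :=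
      fun t ys s => if h : s.1 < t.1 then ys ⟨s.1, h⟩ else true
    let q : (t : Fin n) → (Fin (t.1 + 1) → X) → (Fin t.1 → Bool) → ℝ := fun t xs ys =>
      -(n * (aux_V φ (t.1 + 1) (px t xs) (Function.update (py t ys) t true)
        - aux_V φ (t.1 + 1) (px t xs) (Function.update (py t ys) t false)))
    have hq : ∀ t xs h, |q t xs h| ≤ 1 := by
      intro t xs h
      have h1 := hst (t.1 + 1) t.2 (px t xs) (Function.update (py t h) t true) t false
      have h2 := hst (t.1 + 1) t.2 (px t xs) (Function.update (py t h) t false) t true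
      rw [Function.update_idem] at h1 h2
      simp only [q]
      rw [abs_neg, abs_mul, abs_of_pos hn0, ← le_div_iff₀' hn0, abs_le]
      constructor <;> linarith
    refine ⟨q, hq, ?_⟩
    intro ax ay
    let xx : (Fin n → Bool) → Fin n → X := fun yh t => (run q ax ay yh t).1
    let yy : (Fin n → Bool) → Fin n → Bool := fun yh t => (run q ax ay yh t).2
    let Q : (Fin n → Bool) → Fin n → ℝ := fun yh t =>
      q t (fun s => xx yh ⟨s.1, s.2.trans_le t.isLt⟩) (fun s => yy yh ⟨s.1, s.2.trans t.2⟩)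
    have hxloc : ∀ yh yh' t, (∀ s, s < t → yh s = yh' s) → xx yh t = xx yh' t := by
      intro yh yh' t h
      simp only [xx]
      rw [aux_run_loc _ _ _ yh yh' t.1 t rfl h]
    have hyloc : ∀ yh yh' t, (∀ s, s < t → yh s = yh' s) → yy yh t = yy yh' t := by
      intro yh yh' t h
      simp only [yy]
      rw [aux_run_loc _ _ _ yh yh' t.1 t rfl h]
    have hQ : ∀ yh t, Q yh t = -(n * (aux_V φ (t.1 + 1) (xx yh) (Function.update (yy yh) t true)
        - aux_V φ (t.1 + 1) (xx yh) (Function.update (yy yh) t false))) := by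
      intro yh t
      have e : ∀ b, aux_V φ (t.1 + 1) (px t (fun s => xx yh ⟨s.1, s.2.trans_le t.isLt⟩))
          (Function.update (py t (fun s => yy yh ⟨s.1, s.2.trans t.2⟩)) t b)
          = aux_V φ (t.1 + 1) (xx yh) (Function.update (yy yh) t b) := by
        intro b
        apply aux_V_loc φ (t.1 + 1) t.2
        · intro s hs
          simp only [px, hs, dite_true]
        · intro s hs
          by_cases hsk : s = t
          · subst hsk; simp
          · have h' : s.1 ≠ t.1 := fun h => hsk (Fin.ext h)
            have h2 : s.1 < t.1 := by omega
            rw [Function.update_of_ne hsk, Function.update_of_ne hsk]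
            simp only [py, h2, dite_true]
      simp only [Q, q]
      rw [e, e]
    have hQloc : ∀ yh yh' t, (∀ s, s < t → yh s = yh' s) → Q yh t = Q yh' t := by
      intro yh yh' t h
      have e1 : (fun s : Fin (t.1 + 1) => xx yh ⟨s.1, s.2.trans_le t.isLt⟩)
          = (fun s : Fin (t.1 + 1) => xx yh' ⟨s.1, s.2.trans_le t.isLt⟩) := by
        funext s
        exact hxloc _ _ _ fun u hu => h u (lt_of_lt_of_le hu (Nat.lt_succ_iff.mp s.2))
      have e2 : (fun s : Fin t.1 => yy yh ⟨s.1, s.2.trans t.2⟩)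
          = (fun s : Fin t.1 => yy yh' ⟨s.1, s.2.trans t.2⟩) := by
        funext s
        exact hyloc _ _ _ fun u hu => h u (lt_trans hu s.2)
      simp only [Q]
      rw [e1, e2]
    have hQ1 : ∀ yh t, |Q yh t| ≤ 1 := by
      intro yh t
      simp only [Q]
      exact hq t (fun s => xx yh ⟨s.1, s.2.trans_le t.isLt⟩) (fun s => yy yh ⟨s.1, s.2.trans t.2⟩)
    suffices hgoal : ∑ yh : Fin n → Bool, (∏ t, (1 + sgn (yh t) * Q yh t) / 2)
            * ((1 / n) * ∑ t, if yh t ≠ yy yh t then (1 : ℝ) else 0)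
          ≤ ∑ yh : Fin n → Bool, (∏ t, (1 + sgn (yh t) * Q yh t) / 2) * φ (xx yh) (yy yh) from hgoal
    clear_value Q
    clear_value xx yy
    have hs := aux_super (n := n) (fun t yh => (1 + sgn (yh t) * Q yh t) / 2)
      (fun t yh => aux_sgn_abs _ _ (hQ1 yh t))
      (fun t y y' h => by
        rw [h t le_rfl, hQloc y y' t fun s hs => h s hs.le])
      (fun t y => by
        rw [hQloc _ y t (aux_upd y t true), hQloc _ y t (aux_upd y t false)]
        simp [sgn]; ring)
      (fun k yh => (1 / n) * ∑ t ∈ univ.filter (fun t : Fin n => t.1 < k),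
            (if yh t ≠ yy yh t then (1 : ℝ) else 0) - aux_V φ k (xx yh) (yy yh))
      (1 / (2 * n)) ?_ (fun _ => true)
    · simp only [aux_sum_all, not_lt_zero, filter_false, sum_empty, aux_V_n, mul_sub,
        sum_sub_distrib] at hs
      have h0 := hV0 (xx fun _ => true) (yy fun _ => true)
      have h3 : (n : ℝ) * (1 / (2 * n)) = 1 / 2 := by field_simp
      rw [h3] at hs
      linarith
    · intro k y
      have exx : ∀ b t, t ≤ k → xx (Function.update y k b) t = xx y t := fun b t ht =>
        hxloc _ _ _ fun s hs => aux_upd y k b s (lt_of_lt_of_le hs ht)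
      have eyy : ∀ b t, t ≤ k → yy (Function.update y k b) t = yy y t := fun b t ht =>
        hyloc _ _ _ fun s hs => aux_upd y k b s (lt_of_lt_of_le hs ht)
      have eQ : ∀ b, Q (Function.update y k b) k = Q y k := fun b =>
        hQloc _ _ _ (aux_upd y k b)
      have eV : ∀ b, aux_V φ (k.1 + 1) (xx (Function.update y k b)) (yy (Function.update y k b))
          = aux_V φ (k.1 + 1) (xx y) (yy y) := fun b =>
        aux_V_loc φ (k.1 + 1) k.2 _ _ _ _ (fun s hs => exx b s (Nat.lt_succ_iff.mp hs))
          (fun s hs => eyy b s (Nat.lt_succ_iff.mp hs))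
      have es : ∀ b, ∑ t ∈ univ.filter (fun t : Fin n => t.1 < k.1),
            (if Function.update y k b t ≠ yy (Function.update y k b) t then (1 : ℝ) else 0)
          = ∑ t ∈ univ.filter (fun t : Fin n => t.1 < k.1),
            (if y t ≠ yy y t then (1 : ℝ) else 0) := by
        intro b
        apply aux_sum_congr
        intro t ht
        rw [eyy b t ht.le, aux_upd y k b t ht]
      have hle : aux_V φ k.1 (xx y) (yy y) ≤ _ :=
        (aux_V_lt φ k (xx y) (yy y)).trans_le (ciInf_le (aux_V_bdd φ _ hm k (xx y) (yy y)) (xx y k))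
      rw [Function.update_eq_self] at hle
      have hself : aux_V φ (k.1 + 1) (xx y) (yy y)
          = aux_V φ (k.1 + 1) (xx y) (Function.update (yy y) k (yy y k)) := by
        rw [Function.update_eq_self]
      simp only [aux_sum_succ]
      rw [es, es, eyy _ k le_rfl, eyy _ k le_rfl, eQ, eQ, eV, eV, hQ, hself]
      generalize (∑ t ∈ univ.filter (fun t : Fin n => t.1 < k.1),
            (if y t ≠ yy y t then (1 : ℝ) else 0)) = S
      cases hk : yy y k
      all_goals
        generalize aux_V φ (k.1 + 1) (xx y) (Function.update (yy y) k true) = a at *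
        generalize aux_V φ (k.1 + 1) (xx y) (Function.update (yy y) k false) = b at *
        refine le_trans (le_of_eq (b := 1 / n * S - (a + b) / 2 + 1 / (2 * n)) ?_) (by linarith)
        simp [sgn]
        field_simp
        ring
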